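/- arXiv:0802.0617 — 2 statements merged into one kernel-verified Lean document; each statement's English description precedes it below -/
import Mathlib

section
/- Let Ω = (0,1) ⊂ ℝ and let N_S be the spherical proximity map N_S(x) := {z ∈ (0,1) : |z − x| < min(x, 1−x)} (the open ball centered at x of radius equal to the distance from x to {0,1}). Then for every finite nonempty set B ⊂ (0,1), the Γ1-region of B is the open interval Γ1^{N_S}(B) = ( max(B)/2 , (1 + min(B))/2 ). -/
/-- The spherical proximity map on `Ω = (0,1)` associated with `𝒴 = {0,1}`:
`N_S(x) = B(x, min(x, 1-x)) ∩ (0,1)`, the open ball centered at `x` of radius equal to the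
distance from `x` to `{0,1}`, intersected with `(0,1)`. -/
def NS (x : ℝ) : Set ℝ :=
  {z ∈ Set.Ioo (0 : ℝ) 1 | |z - x| < min x (1 - x)}

/-- The Γ1-region of `B ⊆ (0,1)` for the spherical proximity map:
`Γ1^{N_S}(B) = {z ∈ (0,1) : B ⊆ N_S(z)}`. -/
def Gamma1NS (B : Set ℝ) : Set ℝ :=
  {z ∈ Set.Ioo (0 : ℝ) 1 | B ⊆ NS z}

/-- The ball condition in `NS` amounts to two linear inequalities. -/
theorem mem_NS_iff {x y : ℝ} (hy : y ∈ Set.Ioo (0 : ℝ) 1) :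
    y ∈ NS x ↔ y / 2 < x ∧ x < (1 + y) / 2 := by
  obtain ⟨h0, h1⟩ := hy
  simp only [NS, Set.mem_ofPred_eq, Set.mem_Ioo, lt_min_iff, abs_lt]
  constructor
  · rintro ⟨-, ⟨-, h⟩, ⟨h', -⟩⟩
    constructor <;> linarith
  · rintro ⟨h, h'⟩
    refine ⟨⟨h0, h1⟩, ⟨?_, ?_⟩, ⟨?_, ?_⟩⟩ <;> linarith

/-- For every finite nonempty set `B ⊂ (0,1)`, the Γ1-region of `B` for the spherical
proximity map `N_S` is the open interval `( max(B)/2 , (1 + min(B))/2 )`. -/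
theorem Gamma1NS_eq_Ioo (B : Finset ℝ) (hB : B.Nonempty) (hB01 : ↑B ⊆ Set.Ioo (0 : ℝ) 1) :
    Gamma1NS (B : Set ℝ) = Set.Ioo (B.max' hB / 2) ((1 + B.min' hB) / 2) := by
  have hmax := hB01 (B.max'_mem hB)
  have hmin := hB01 (B.min'_mem hB)
  ext z
  constructor
  · rintro ⟨-, hz⟩
    exact ⟨((mem_NS_iff hmax).1 (hz (B.max'_mem hB))).1,
      ((mem_NS_iff hmin).1 (hz (B.min'_mem hB))).2⟩
  · rintro ⟨hz, hz'⟩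
    refine ⟨⟨by linarith [hmax.1], by linarith [hmin.2]⟩, fun y hy => ?_⟩
    have hle := B.le_max' y hy
    have hge := B.min'_le y hy
    exact (mem_NS_iff (hB01 hy)).2 ⟨by linarith, by linarith⟩
end

section
/- Fix r ∈ [1,∞) and M in the interior of the triangle T, and let R_S(r, M) := {x ∈ T : N_PE^r(x, M) = T} be the superset region. Then: (i) if M lies in the interior of 𝒯_r, then R_S(r, M) = ∅; (ii) if M lies on the boundary of 𝒯_r, then R_S(r, M) ⊆ {M}; (iii) if M ∉ 𝒯_r, then R_S(r, M) has positive two-dimensional Lebesgue measure. -/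
open MeasureTheory ProbabilityTheory Filter Metric
open scoped ENNReal

noncomputable section

/-- The Euclidean plane. -/
abbrev Plane : Type := EuclideanSpace ℝ (Fin 2)

/-- The closed triangle `T` with vertices `b 0, b 1, b 2` (three non-collinear points,
given as an affine basis of the plane). -/
def Tri (b : AffineBasis (Fin 3) ℝ Plane) : Set Plane :=
  convexHull ℝ (Set.range (fun j => b j))

/-- The edge of the triangle opposite to the vertex `b j`. -/
def edg (b : AffineBasis (Fin 3) ℝ Plane) (j : Fin 3) : Set Plane :=
  convexHull ℝ ((fun i => b i) '' {i | i ≠ j})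

/-- The `M`-vertex region of the vertex `b j`: the set of points `x` of the triangle whose
`j`-th barycentric coordinate, relative to the barycentric coordinates of `M`, is largest;
this is exactly the quadrilateral with vertices `b j`, `M` and the two points where the rays
from the other two vertices through `M` hit the opposite edges. -/
def vertexRegion (b : AffineBasis (Fin 3) ℝ Plane) (M : Plane) (j : Fin 3) : Set Plane :=
  {x ∈ Tri b | ∀ k, b.coord j M * b.coord k x ≤ b.coord k M * b.coord j x}

/-- The `r`-factor proportional-edge proximity region `N_PE^r(x, M)`, for a vertex-assignment
map `v` (sending each point of the triangle to a vertex whose `M`-vertex region contains it;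
this encodes the tie-breaking rule).  It is `T ∩ h_x(T)` where `h_x` is the homothety centered
at the vertex `b (v x)` with ratio `r · d(v(x), ℓ(v(x),x)) / d(v(x), e(x)) = r (1 - β_{v x}(x))`. -/
def NPE (b : AffineBasis (Fin 3) ℝ Plane) (r : ℝ) (v : Plane → Fin 3) (x : Plane) :
    Set Plane :=
  Tri b ∩ (AffineMap.homothety (b (v x)) (r * (1 - b.coord (v x) x))) '' Tri b

/-- The domination number of the proximity catch digraph with vertex set `V` and an arc from
`w` to `u` (for `u ≠ w`) iff `u ∈ N w`: the least cardinality of a subset `S ⊆ V` such that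
every `u ∈ V` is dominated by some `w ∈ S` (i.e. `u = w` or `u ∈ N w`). -/
def domNum {α : Type*} (N : α → Set α) (V : Finset α) : ℕ :=
  sInf {k | ∃ S : Finset α, S ⊆ V ∧ (∀ u ∈ V, ∃ w ∈ S, u = w ∨ u ∈ N w) ∧ S.card = k}

/-- The (random) vertex set `{X_1, ..., X_n}`. -/
def pts {Ω : Type*} (X : ℕ → Ω → Plane) (n : ℕ) (ω : Ω) : Finset Plane :=
  letI := Classical.decEq Plane
  Finset.image (fun i : Fin n => X i.val ω) Finset.univ

/-- `γ_n(r, M)` : the domination number of the PCD on `{X_1,...,X_n}` based on `N_PE^r(·, M)`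
(with vertex-assignment map `v` for the `M`-vertex regions). -/
def gammaN {Ω : Type*} (b : AffineBasis (Fin 3) ℝ Plane) (r : ℝ) (v : Plane → Fin 3)
    (X : ℕ → Ω → Plane) (n : ℕ) (ω : Ω) : ℕ :=
  domNum (NPE b r v) (pts X n ω)

/-- The uniform distribution on the triangle. -/
def unifTri (b : AffineBasis (Fin 3) ℝ Plane) : Measure Plane :=
  (volume (Tri b))⁻¹ • volume.restrict (Tri b)

/-- The triangle `𝒯_r = {x ∈ T : β_j(x) ≥ (r-1)/r for j = 1,2,3}` (empty for `r > 3/2`). -/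
def TrSet (b : AffineBasis (Fin 3) ℝ Plane) (r : ℝ) : Set Plane :=
  {x ∈ Tri b | ∀ j, (r - 1) / r ≤ b.coord j x}

/-- The vertex `t_j(r)` of `𝒯_r`: barycentric coordinate `(2-r)/r` at `j` and `(r-1)/r`
at the other two indices. -/
def tVert (b : AffineBasis (Fin 3) ℝ Plane) (r : ℝ) (j : Fin 3) : Plane :=
  Finset.univ.affineCombination ℝ (fun i => b i)
    (fun i => if i = j then (2 - r) / r else (r - 1) / r)

end

/-- The triangle is the set of points with non-negative barycentric coordinates. -/
theorem mem_Tri_iff (b : AffineBasis (Fin 3) ℝ Plane) (x : Plane) :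
    x ∈ Tri b ↔ ∀ j, 0 ≤ b.coord j x := by
  unfold Tri
  rw [show (Set.range fun j => b j) = Set.range b from rfl,
    AffineBasis.convexHull_eq_nonneg_coord]
  rfl

theorem AffineBasis.coord_homothety (b : AffineBasis (Fin 3) ℝ Plane) (i j : Fin 3) (c : ℝ)
    (y : Plane) :
    b.coord i (AffineMap.homothety (b j) c y) =
      c * b.coord i y + (1 - c) * b.coord i (b j) := by
  rw [AffineMap.homothety_eq_lineMap, AffineMap.apply_lineMap, AffineMap.lineMap_apply_ring']
  ring

/-- The proximity region of `x` is the whole triangle iff the homothety ratio is at least `1`. -/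
theorem NPE_eq_Tri_iff (b : AffineBasis (Fin 3) ℝ Plane) {r : ℝ} (hr : 1 ≤ r)
    (v : Plane → Fin 3) {x : Plane} (hx : x ∈ Tri b) :
    NPE b r v x = Tri b ↔ b.coord (v x) x ≤ (r - 1) / r := by
  have hr0 : 0 < r := by linarith
  have hsum := b.sum_coord_apply_eq_one x
  have hx' := (mem_Tri_iff b x).1 hx
  have hle : b.coord (v x) x ≤ 1 := by
    rw [← hsum]
    exact Finset.single_le_sum (fun i _ => hx' i) (Finset.mem_univ _)
  unfold NPE
  generalize v x = j at hle ⊢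
  rw [Set.inter_eq_left, le_div_iff₀ hr0]
  constructor
  · intro h
    obtain ⟨k, hk⟩ : ∃ k, k ≠ j := exists_ne j
    have hbk : b k ∈ Tri b := subset_convexHull ℝ _ ⟨k, rfl⟩
    obtain ⟨z, hz, hzk⟩ := h hbk
    have h1 := congrArg (b.coord j) hzk
    rw [b.coord_homothety, b.coord_apply_eq, b.coord_apply_ne hk.symm] at h1
    have h2 : 0 ≤ r * (1 - b.coord j x) := mul_nonneg hr0.le (by linarith)
    have h3 := mul_nonneg h2 ((mem_Tri_iff b z).1 hz j)
    linarith
  · intro h y hy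
    have hc : 1 ≤ r * (1 - b.coord j x) := by linarith
    generalize r * (1 - b.coord j x) = c at hc
    have hc0 : 0 < c := by linarith
    refine ⟨AffineMap.homothety (b j) c⁻¹ y, ?_, ?_⟩
    · rw [mem_Tri_iff] at hy ⊢
      intro i
      rw [b.coord_homothety]
      have h1 : c⁻¹ ≤ 1 := inv_le_one_of_one_le₀ hc
      have h2 : 0 ≤ b.coord i (b j) :=
        (mem_Tri_iff b _).1 (subset_convexHull ℝ _ ⟨j, rfl⟩) i
      exact add_nonneg (mul_nonneg (inv_nonneg.2 hc0.le) (hy i))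
        (mul_nonneg (by linarith) h2)
    · rw [← AffineMap.homothety_mul_apply, mul_inv_cancel₀ hc0.ne',
        AffineMap.homothety_one, AffineMap.id_apply]

/-- A point of the vertex region of `b j` has `j`-th coordinate at least that of `M`. -/
theorem coord_le_coord_of_mem_vertexRegion {b : AffineBasis (Fin 3) ℝ Plane} {M x : Plane}
    {j : Fin 3} (hx : x ∈ vertexRegion b M j) : b.coord j M ≤ b.coord j x := by
  have h := Finset.sum_le_sum fun k (_ : k ∈ Finset.univ) => hx.2 k
  rwa [← Finset.mul_sum, ← Finset.sum_mul, b.sum_coord_apply_eq_one,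
    b.sum_coord_apply_eq_one, mul_one, one_mul] at h

/-- `M` is the only point of its vertex region sharing its coordinate at that vertex. -/
theorem eq_of_mem_vertexRegion_of_coord_eq {b : AffineBasis (Fin 3) ℝ Plane} {M x : Plane}
    {j : Fin 3} (hM : 0 < b.coord j M) (hx : x ∈ vertexRegion b M j)
    (h : b.coord j x = b.coord j M) : x = M := by
  have hle : ∀ k ∈ Finset.univ, b.coord k x ≤ b.coord k M := by
    intro k _
    have := hx.2 k
    rw [h, mul_comm (b.coord k M)] at this
    exact le_of_mul_le_mul_left this hM
  refine b.ext_elem fun k => ?_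
  refine (Finset.sum_eq_sum_iff_of_le hle).1 ?_ k (Finset.mem_univ _)
  rw [b.sum_coord_apply_eq_one, b.sum_coord_apply_eq_one]

theorem isClosed_TrSet (b : AffineBasis (Fin 3) ℝ Plane) (r : ℝ) : IsClosed (TrSet b r) := by
  have : TrSet b r = ⋂ j, {x | 0 ≤ b.coord j x} ∩ {x | (r - 1) / r ≤ b.coord j x} := by
    ext x
    simp [TrSet, mem_Tri_iff, forall_and]
  rw [this]
  exact isClosed_iInter fun j =>
    (isClosed_le continuous_const (continuous_barycentric_coord b j)).inter
      (isClosed_le continuous_const (continuous_barycentric_coord b j))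

theorem lt_coord_of_mem_interior_TrSet {b : AffineBasis (Fin 3) ℝ Plane} {r : ℝ} {M : Plane}
    (hM : M ∈ interior (TrSet b r)) (j : Fin 3) : (r - 1) / r < b.coord j M := by
  have hsub : TrSet b r ⊆ b.coord j ⁻¹' Set.Ici ((r - 1) / r) := fun x hx => hx.2 j
  have h := interior_mono hsub hM
  rw [← (isOpenMap_barycentric_coord b j).preimage_interior_eq_interior_preimage
    (continuous_barycentric_coord b j), interior_Ici] at h
  exact h

/-- If `M` has some coordinate below `(r - 1) / r`, the superset region contains a nonempty
open set. -/
theorem volume_supersetRegion_pos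
    (b : AffineBasis (Fin 3) ℝ Plane) (M : Plane) (hM : ∀ j, 0 < b.coord j M)
    (v : Plane → Fin 3) (hv : ∀ x ∈ Tri b, x ∈ vertexRegion b M (v x))
    {r : ℝ} (hr : 1 ≤ r) {j : Fin 3} (hj : b.coord j M < (r - 1) / r) :
    0 < volume {x ∈ Tri b | NPE b r v x = Tri b} := by
  set U : Set Plane := (⋂ k, {x | 0 < b.coord k x}) ∩ {x | b.coord j x < (r - 1) / r} ∩
    ⋂ k, {x | k ≠ j → b.coord j M * b.coord k x < b.coord k M * b.coord j x}
  have hUo : IsOpen U := by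
    refine ((isOpen_iInter_of_finite fun k =>
      isOpen_lt continuous_const (continuous_barycentric_coord b k)).inter
      (isOpen_lt (continuous_barycentric_coord b j) continuous_const)).inter
      (isOpen_iInter_of_finite fun k => ?_)
    by_cases hk : k = j
    · simp [hk]
    · simpa [hk] using isOpen_lt ((continuous_barycentric_coord b k).const_mul (b.coord j M))
        ((continuous_barycentric_coord b j).const_mul (b.coord k M))
  have hUne : U.Nonempty := by
    have hs : (r - 1) / r < 1 := by rw [div_lt_one (by linarith)]; linarith
    set ε : ℝ := ((r - 1) / r - b.coord j M) / 2 with hε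
    have hε0 : 0 < ε := by linarith
    have hε1 : ε < 1 := by linarith [hM j]
    refine ⟨AffineMap.homothety (b j) (1 - ε) M, ⟨Set.mem_iInter.2 fun k => ?_, ?_⟩,
      Set.mem_iInter.2 fun k hk => ?_⟩
    · have h2 : 0 ≤ b.coord k (b j) :=
        (mem_Tri_iff b _).1 (subset_convexHull ℝ _ ⟨j, rfl⟩) k
      rw [Set.mem_ofPred_eq, b.coord_homothety]
      exact add_pos_of_pos_of_nonneg (mul_pos (by linarith) (hM k))
        (mul_nonneg (by linarith) h2)
    · rw [Set.mem_ofPred_eq, b.coord_homothety, b.coord_apply_eq]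
      nlinarith [mul_pos hε0 (hM j)]
    · rw [b.coord_homothety, b.coord_homothety, b.coord_apply_eq, b.coord_apply_ne hk]
      nlinarith [mul_pos hε0 (hM k)]
  refine (hUo.measure_pos volume hUne).trans_le (measure_mono ?_)
  rintro x ⟨⟨hpos, hlt⟩, hreg⟩
  rw [Set.mem_iInter] at hpos hreg
  have hxT : x ∈ Tri b := (mem_Tri_iff b x).2 fun k => (hpos k).le
  have hvx : v x = j := by
    by_contra hne
    have h1 := hreg (v x) hne
    have h2 := (hv x hxT).2 j
    linarith
  exact ⟨hxT, (NPE_eq_Tri_iff b hr v hxT).2 (hvx ▸ hlt.le)⟩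


/-- Fix `r ∈ [1,∞)` and `M` in the interior of the triangle `T`, and let
`R_S(r, M) = {x ∈ T : N_PE^r(x, M) = T}` be the superset region.  Then:
(i) if `M` lies in the interior of `𝒯_r` then `R_S(r, M) = ∅`;
(ii) if `M` lies on the boundary of `𝒯_r` then `R_S(r, M) ⊆ {M}`;
(iii) if `M ∉ 𝒯_r` then `R_S(r, M)` has positive two-dimensional Lebesgue measure. -/
theorem supersetRegion_NPE_trichotomy
    (b : AffineBasis (Fin 3) ℝ Plane) (M : Plane) (hM : ∀ j, 0 < b.coord j M)
    (v : Plane → Fin 3) (hv : ∀ x ∈ Tri b, x ∈ vertexRegion b M (v x))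
    (r : ℝ) (hr : 1 ≤ r) :
    (M ∈ interior (TrSet b r) → {x ∈ Tri b | NPE b r v x = Tri b} = ∅) ∧
    (M ∈ frontier (TrSet b r) → {x ∈ Tri b | NPE b r v x = Tri b} ⊆ {M}) ∧
    (M ∉ TrSet b r → 0 < volume {x ∈ Tri b | NPE b r v x = Tri b}) := by
  refine ⟨fun h => ?_, fun h => ?_, fun h => ?_⟩
  · refine Set.eq_empty_of_forall_notMem ?_
    rintro x ⟨hxT, hx⟩
    have h1 := (NPE_eq_Tri_iff b hr v hxT).1 hx
    have h2 := coord_le_coord_of_mem_vertexRegion (hv x hxT)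
    have h3 := lt_coord_of_mem_interior_TrSet h (v x)
    linarith
  · rintro x ⟨hxT, hx⟩
    have h1 := (NPE_eq_Tri_iff b hr v hxT).1 hx
    have h2 := coord_le_coord_of_mem_vertexRegion (hv x hxT)
    have h3 := ((isClosed_TrSet b r).frontier_subset h).2 (v x)
    exact eq_of_mem_vertexRegion_of_coord_eq (hM _) (hv x hxT) (by linarith)
  · have hMT : M ∈ Tri b := (mem_Tri_iff b M).2 fun k => (hM k).le
    obtain ⟨j, hj⟩ : ∃ j, b.coord j M < (r - 1) / r := by
      by_contra! hcon
      exact h ⟨hMT, hcon⟩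
    exact volume_supersetRegion_pos b M hM v hv hr hj
end
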